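/- Let X, Y, E, Z, S, T be random variables on a common probability space, each taking values in a standard Borel space, with E measurable with respect to σ(S) and S measurable with respect to σ(T). If T is conditionally independent of the pair (X, Y) given (Z, S), and X is conditionally independent of the pair (S, Y) given (Z, E), then X is conditionally independent of T given the pair (Z, E). (This establishes the 'distributed updating' conclusion of the paper's Theorem 1: each panel may update its own parameter θ_i = X using only the common information I₀ = Z and its own information I_{ii} = E, where T = I₊ is the totality of admissible evidence and S = I_*.) -/

import Mathlib

open MeasureTheory ProbabilityTheory MeasurableSpace

namespace ProbabilityTheory

variable {Ω : Type*} {m m₁ m₂ m₃ mΩ : MeasurableSpace Ω} {μ : Measure Ω}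

theorem sup_eq_generateFrom_inter (m₁ m₂ : MeasurableSpace Ω) :
    m₁ ⊔ m₂ =
      generateFrom {s | ∃ u v, MeasurableSet[m₁] u ∧ MeasurableSet[m₂] v ∧ u ∩ v = s} := by
  refine le_antisymm (sup_le (fun u hu ↦ ?_) fun v hv ↦ ?_) (generateFrom_le ?_)
  · exact measurableSet_generateFrom ⟨u, Set.univ, hu, .univ, Set.inter_univ u⟩
  · exact measurableSet_generateFrom ⟨Set.univ, v, .univ, hv, Set.univ_inter v⟩
  · rintro _ ⟨u, v, hu, hv, rfl⟩
    exact MeasurableSet.inter ((le_sup_left : m₁ ≤ m₁ ⊔ m₂) u hu)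
      ((le_sup_right : m₂ ≤ m₁ ⊔ m₂) v hv)

theorem isPiSystem_inter_measurableSet (m₁ m₂ : MeasurableSpace Ω) :
    IsPiSystem {s | ∃ u v, MeasurableSet[m₁] u ∧ MeasurableSet[m₂] v ∧ u ∩ v = s} := by
  rintro _ ⟨u, v, hu, hv, rfl⟩ _ ⟨u', v', hu', hv', rfl⟩ -
  exact ⟨u ∩ u', v ∩ v', hu.inter hu', hv.inter hv', Set.inter_inter_inter_comm u u' v v'⟩

/-- Two integrable functions with the same integral over every intersection of an `m₁`-measurable
set and an `m₂`-measurable set have the same integral over every `m₁ ⊔ m₂`-measurable set. -/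
theorem setIntegral_eq_of_forall_inter (hm₁ : m₁ ≤ mΩ) (hm₂ : m₂ ≤ mΩ) {f g : Ω → ℝ}
    (hf : Integrable f μ) (hg : Integrable g μ)
    (h : ∀ u v, MeasurableSet[m₁] u → MeasurableSet[m₂] v →
      ∫ ω in u ∩ v, f ω ∂μ = ∫ ω in u ∩ v, g ω ∂μ)
    {s : Set Ω} (hs : MeasurableSet[m₁ ⊔ m₂] s) :
    ∫ ω in s, f ω ∂μ = ∫ ω in s, g ω ∂μ := by
  have hle : m₁ ⊔ m₂ ≤ mΩ := sup_le hm₁ hm₂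
  induction s, hs using induction_on_inter (sup_eq_generateFrom_inter m₁ m₂)
    (isPiSystem_inter_measurableSet m₁ m₂) with
  | empty => simp
  | basic s hs =>
    obtain ⟨u, v, hu, hv, rfl⟩ := hs
    exact h u v hu hv
  | compl s hs ih =>
    have huniv : ∫ ω, f ω ∂μ = ∫ ω, g ω ∂μ := by
      simpa using h Set.univ Set.univ .univ .univ
    rw [setIntegral_compl (hle s hs) hf, setIntegral_compl (hle s hs) hg, ih, huniv]
  | iUnion s hd hs ih =>
    rw [integral_iUnion (fun i ↦ hle _ (hs i)) hd hf.integrableOn,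
      integral_iUnion (fun i ↦ hle _ (hs i)) hd hg.integrableOn]
    exact tsum_congr ih

theorem ae_norm_condExp_indicator_one_le (s : Set Ω) : ∀ᵐ ω ∂μ, ‖(μ⟦s | m⟧) ω‖ ≤ 1 :=
  ae_bdd_abs_condExp_of_ae_bdd_abs <| .of_forall fun ω ↦ by
    by_cases hω : ω ∈ s <;> simp [hω]

variable [IsFiniteMeasure μ] [StandardBorelSpace Ω]

/-- If `m₁` and `m₂` are conditionally independent given `m`, then adding `m₂` to the
conditioning does not change the conditional probability of an event of `m₁`. -/
theorem CondIndep.condExp_sup_ae_eq (hm : m ≤ mΩ) (hm₁ : m₁ ≤ mΩ) (hm₂ : m₂ ≤ mΩ)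
    (h : CondIndep m m₁ m₂ hm μ) {s : Set Ω} (hs : MeasurableSet[m₁] s) :
    μ⟦s | m ⊔ m₂⟧ =ᵐ[μ] μ⟦s | m⟧ := by
  have h_int {t : Set Ω} (ht : MeasurableSet t) : Integrable (t.indicator fun _ ↦ (1 : ℝ)) μ :=
    (integrable_const _).indicator ht
  refine (ae_eq_condExp_of_forall_setIntegral_eq (sup_le hm hm₂) (h_int (hm₁ s hs))
    (fun t _ _ ↦ integrable_condExp.integrableOn) (fun t ht _ ↦ ?_)
    (stronglyMeasurable_condExp.mono (le_sup_left : m ≤ m ⊔ m₂)).aestronglyMeasurable).symm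
  refine setIntegral_eq_of_forall_inter hm hm₂ integrable_condExp (h_int (hm₁ s hs)) ?_ ht
  intro u v hu hv
  have hvΩ := hm₂ v hv
  have hmul : (v.indicator (μ⟦s | m⟧)) = μ⟦s | m⟧ * v.indicator fun _ ↦ (1 : ℝ) := by
    ext ω; by_cases hω : ω ∈ v <;> simp [hω]
  have hpull : μ[v.indicator (μ⟦s | m⟧) | m] =ᵐ[μ] μ⟦s ∩ v | m⟧ := by
    rw [hmul]
    exact (condExp_stronglyMeasurable_mul_of_bound hm stronglyMeasurable_condExp (h_int hvΩ) 1
      (ae_norm_condExp_indicator_one_le s)).trans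
      ((condIndep_iff m m₁ m₂ hm hm₁ hm₂ μ).1 h s v hs hv).symm
  calc ∫ ω in u ∩ v, (μ⟦s | m⟧) ω ∂μ
      = ∫ ω in u, v.indicator (μ⟦s | m⟧) ω ∂μ := (setIntegral_indicator hvΩ).symm
    _ = ∫ ω in u, (μ[v.indicator (μ⟦s | m⟧) | m]) ω ∂μ :=
      (setIntegral_condExp hm (integrable_condExp.indicator hvΩ) hu).symm
    _ = ∫ ω in u, (μ⟦s ∩ v | m⟧) ω ∂μ := integral_congr_ae (ae_restrict_of_ae hpull)
    _ = ∫ ω in u, (s ∩ v).indicator (fun _ ↦ (1 : ℝ)) ω ∂μ :=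
      setIntegral_condExp hm (h_int ((hm₁ s hs).inter hvΩ)) hu
    _ = ∫ ω in u ∩ v, s.indicator (fun _ ↦ (1 : ℝ)) ω ∂μ := by
      rw [← setIntegral_indicator hvΩ, Set.indicator_indicator, Set.inter_comm]

/-- The contraction property of conditional independence. -/
theorem CondIndep.contraction (hm : m ≤ mΩ) (hm₁ : m₁ ≤ mΩ) (hm₂ : m₂ ≤ mΩ) (hm₃ : m₃ ≤ mΩ)
    (h : CondIndep m m₁ m₂ hm μ) (h' : CondIndep (m ⊔ m₂) m₁ m₃ (sup_le hm hm₂) μ) :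
    CondIndep m m₁ m₃ hm μ := by
  rw [condIndep_iff _ _ _ _ hm₁ hm₃] at h' ⊢
  intro s t hs ht
  have htower (r : Set Ω) : μ[μ⟦r | m ⊔ m₂⟧ | m] =ᵐ[μ] μ⟦r | m⟧ :=
    condExp_condExp_of_le le_sup_left (sup_le hm hm₂)
  calc μ⟦s ∩ t | m⟧
      =ᵐ[μ] μ[μ⟦s ∩ t | m ⊔ m₂⟧ | m] := (htower _).symm
    _ =ᵐ[μ] μ[μ⟦s | m⟧ * μ⟦t | m ⊔ m₂⟧ | m] := condExp_congr_ae <|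
      (h' s t hs ht).trans <| (h.condExp_sup_ae_eq hm hm₁ hm₂ hs).mul .rfl
    _ =ᵐ[μ] μ⟦s | m⟧ * μ[μ⟦t | m ⊔ m₂⟧ | m] :=
      condExp_stronglyMeasurable_mul_of_bound hm stronglyMeasurable_condExp integrable_condExp 1
        (ae_norm_condExp_indicator_one_le s)
    _ =ᵐ[μ] μ⟦s | m⟧ * μ⟦t | m⟧ := Filter.EventuallyEq.rfl.mul (htower t)

end ProbabilityTheory

/-- Distributed-updating step of Theorem 1 of the paper: suppose `E` is `σ(S)`-measurable and
`S` is `σ(T)`-measurable.  If `T ⫫ (X, Y) | (Z, S)` and `X ⫫ (S, Y) | (Z, E)`, then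
`X ⫫ T | (Z, E)`.  Conditioning on several variables means conditioning on the join of the
σ-algebras they generate. -/
theorem stmt4_distributed_updating
    {Ω α β γ δ ε ζ : Type*}
    [MeasurableSpace Ω] [StandardBorelSpace Ω] [Nonempty Ω]
    [MeasurableSpace α] [StandardBorelSpace α]
    [MeasurableSpace β] [StandardBorelSpace β]
    [MeasurableSpace γ] [StandardBorelSpace γ]
    [MeasurableSpace δ] [StandardBorelSpace δ]
    [MeasurableSpace ε] [StandardBorelSpace ε]
    [MeasurableSpace ζ] [StandardBorelSpace ζ]
    (μ : Measure Ω) [IsProbabilityMeasure μ]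
    {X : Ω → α} {Y : Ω → β} {E : Ω → γ} {Z : Ω → δ} {S : Ω → ε} {T : Ω → ζ}
    (hX : Measurable X) (hY : Measurable Y) (hE : Measurable E) (hZ : Measurable Z)
    (hS : Measurable S) (hT : Measurable T)
    (hES : MeasurableSpace.comap E inferInstance ≤ MeasurableSpace.comap S inferInstance)
    (hST : MeasurableSpace.comap S inferInstance ≤ MeasurableSpace.comap T inferInstance)
    (h1 : CondIndepFun
        (MeasurableSpace.comap Z inferInstance ⊔ MeasurableSpace.comap S inferInstance)
        (sup_le hZ.comap_le hS.comap_le) T (fun ω => (X ω, Y ω)) μ)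
    (h2 : CondIndepFun
        (MeasurableSpace.comap Z inferInstance ⊔ MeasurableSpace.comap E inferInstance)
        (sup_le hZ.comap_le hE.comap_le) X (fun ω => (S ω, Y ω)) μ) :
    CondIndepFun
      (MeasurableSpace.comap Z inferInstance ⊔ MeasurableSpace.comap E inferInstance)
      (sup_le hZ.comap_le hE.comap_le) X T μ := by
  have hsup : MeasurableSpace.comap Z inferInstance ⊔ MeasurableSpace.comap S inferInstance =
      MeasurableSpace.comap Z inferInstance ⊔ MeasurableSpace.comap E inferInstance ⊔
        MeasurableSpace.comap S inferInstance := by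
    rw [sup_assoc, sup_eq_right.2 hES]
  have hXS := (condIndepFun_iff_condIndep ..).1 (h2.comp measurable_id measurable_fst)
  have hXT := (condIndepFun_iff_condIndep ..).1 (h1.symm.comp measurable_fst measurable_id)
  simp only [hsup] at hXT
  exact (condIndepFun_iff_condIndep ..).2 <|
    CondIndep.contraction _ hX.comap_le hS.comap_le hT.comap_le hXS hXT
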